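/- arXiv:2110.06816 — 3 statements merged into one kernel-verified Lean document; each statement's English description precedes it below -/
import Mathlib

section
/- Let μ be a probability distribution on the n×m pixel grid and δ a flow such that ν = Δ(μ, δ) is also a probability distribution. Then W₁(μ, ν) ≤ ‖δ‖₁, where ‖δ‖₁ is the sum of the absolute values of all entries of δ. -/
namespace WassersteinFlow

/-- A flow on the `n × m` grid: a pair `(δ→, δ↓)` with `δ→ ∈ ℝ^{n×(m-1)}`
and `δ↓ ∈ ℝ^{(n-1)×m}`. -/
abbrev Flow (n m : ℕ) := (Fin n → Fin (m - 1) → ℝ) × (Fin (n - 1) → Fin m → ℝ)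

/-- Entry access with out-of-range indices giving `0` (0-based indices). -/
def entry {a b : ℕ} (δ : Fin a → Fin b → ℝ) (i j : ℤ) : ℝ :=
  if h : 0 ≤ i ∧ i < (a : ℤ) ∧ 0 ≤ j ∧ j < (b : ℤ) then
    δ ⟨i.toNat, by omega⟩ ⟨j.toNat, by omega⟩
  else 0

/-- The flow application map `Δ`:
`Δ(μ,δ)_{i,j} = μ_{i,j} + δ↓_{i−1,j} + δ→_{i,j−1} − δ↓_{i,j} − δ→_{i,j}`,
with out-of-range entries taken to be `0`. -/
def applyFlow {n m : ℕ} (μ : Fin n × Fin m → ℝ) (δ : Flow n m) : Fin n × Fin m → ℝ :=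
  fun x =>
    μ x + entry δ.2 ((x.1 : ℤ) - 1) (x.2 : ℤ) + entry δ.1 (x.1 : ℤ) ((x.2 : ℤ) - 1)
      - entry δ.2 (x.1 : ℤ) (x.2 : ℤ) - entry δ.1 (x.1 : ℤ) (x.2 : ℤ)

/-- The `L¹`-norm of a flow: the sum of absolute values of all entries. -/
def flowL1 {n m : ℕ} (δ : Flow n m) : ℝ :=
  (∑ i, ∑ j, |δ.1 i j|) + (∑ i, ∑ j, |δ.2 i j|)

/-- A probability distribution on the grid. -/
def IsProbDist {n m : ℕ} (μ : Fin n × Fin m → ℝ) : Prop :=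
  (∀ x, 0 ≤ μ x) ∧ ∑ x, μ x = 1

/-- The `L¹` ground metric `d((i,j),(k,l)) = |i−k| + |j−l|` on the grid. -/
def gd {n m : ℕ} (x y : Fin n × Fin m) : ℝ :=
  ((|(x.1 : ℤ) - (y.1 : ℤ)| + |(x.2 : ℤ) - (y.2 : ℤ)| : ℤ) : ℝ)

/-- `π` is a coupling of `μ` and `ν`. -/
def IsCoupling {n m : ℕ} (μ ν : Fin n × Fin m → ℝ)
    (π : (Fin n × Fin m) × (Fin n × Fin m) → ℝ) : Prop :=
  (∀ p, 0 ≤ π p) ∧ (∀ x, ∑ y, π (x, y) = μ x) ∧ (∀ y, ∑ x, π (x, y) = ν y)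

/-- The 1-Wasserstein distance with `L¹` ground metric. -/
noncomputable def W1 {n m : ℕ} (μ ν : Fin n × Fin m → ℝ) : ℝ :=
  sInf {c | ∃ π, IsCoupling μ ν π ∧
    c = ∑ p : (Fin n × Fin m) × (Fin n × Fin m), gd p.1 p.2 * π p}

/-- Index type for flattened flows. -/
abbrev FlowIdx (n m : ℕ) := (Fin n × Fin (m - 1)) ⊕ (Fin (n - 1) × Fin m)

/-- Flatten a flow to a vector in `ℝ^{n(m−1)+(n−1)m}`. -/
def flat {n m : ℕ} (δ : Flow n m) : FlowIdx n m → ℝ :=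
  Sum.elim (fun p => δ.1 p.1 p.2) (fun p => δ.2 p.1 p.2)

section Transshipment

variable {V : Type*} [Fintype V] [DecidableEq V]

/-- Rerouting mass that passes through a vertex `v` with no loop at `v`: the mass `t` removed from
the marginals at `v` is sent directly, which does not increase the cost by the triangle
inequality. -/
lemma exists_reroute_of_loopless {d : V → V → ℝ} (htri : ∀ x y z, d x z ≤ d x y + d y z)
    {f : V → V → ℝ} {p q : V → ℝ} (hf : ∀ x y, 0 ≤ f x y) (hp : ∀ x, ∑ y, f x y = p x)
    (hq : ∀ y, ∑ x, f x y = q y) {v : V} (hv : f v v = 0) {t : ℝ} (ht : 0 < t)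
    (htp : t ≤ p v) (htq : t ≤ q v) :
    ∃ g : V → V → ℝ, (∀ x y, 0 ≤ g x y) ∧
      (∀ x, ∑ y, g x y = p x - if x = v then t else 0) ∧
      (∀ y, ∑ x, g x y = q y - if y = v then t else 0) ∧
      ∑ x, ∑ y, d x y * g x y ≤ ∑ x, ∑ y, d x y * f x y := by
  have hp0 : 0 < p v := ht.trans_le htp
  have hq0 : 0 < q v := ht.trans_le htq
  set r : V → ℝ := fun y => f v y / p v with hr
  set c : V → ℝ := fun x => f x v / q v with hc
  have hr0 : ∀ y, 0 ≤ r y := fun y => div_nonneg (hf _ _) hp0.le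
  have hc0 : ∀ x, 0 ≤ c x := fun x => div_nonneg (hf _ _) hq0.le
  have hr1 : ∑ y, r y = 1 := by rw [← Finset.sum_div, hp, div_self hp0.ne']
  have hc1 : ∑ x, c x = 1 := by rw [← Finset.sum_div, hq, div_self hq0.ne']
  have hrf : ∀ y, t * r y ≤ f v y := fun y => by
    have : f v y = p v * r y := by simp only [hr]; field_simp
    rw [this]; exact mul_le_mul_of_nonneg_right htp (hr0 y)
  have hcf : ∀ x, t * c x ≤ f x v := fun x => by
    have : f x v = q v * c x := by simp only [hc]; field_simp
    rw [this]; exact mul_le_mul_of_nonneg_right htq (hc0 x)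
  have hrv : r v = 0 := by simp [hr, hv]
  have hcv : c v = 0 := by simp [hc, hv]
  refine ⟨fun x y => f x y - (if x = v then t * r y else 0) - (if y = v then t * c x else 0)
    + t * c x * r y, ?_, ?_, ?_, ?_⟩
  · intro x y
    have h := mul_nonneg (mul_nonneg ht.le (hc0 x)) (hr0 y)
    by_cases hx : x = v <;> by_cases hy : y = v
    · subst hx; subst hy; simp [hrv, hcv, hv]
    · subst hx; simpa [hy, hcv] using hrf y
    · subst hy; simpa [hx, hrv] using hcf x
    · simpa [hx, hy] using add_nonneg (hf x y) h
  · intro x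
    have h : ∑ y, (if x = v then t * r y else 0) = if x = v then t else 0 := by
      split_ifs <;> simp [← Finset.mul_sum, hr1]
    simp [Finset.sum_add_distrib, Finset.sum_sub_distrib, h, hp, ← Finset.mul_sum, hr1]
  · intro y
    have h : ∑ x, (if y = v then t * c x else 0) = if y = v then t else 0 := by
      split_ifs <;> simp [← Finset.mul_sum, hc1]
    simp only [Finset.sum_add_distrib, Finset.sum_sub_distrib, h, hq, ← Finset.mul_sum,
      ← Finset.sum_mul, hc1, Finset.sum_ite_eq', Finset.mem_univ, if_true]
    ring
  · have hA : ∑ x, ∑ y, d x y * (if x = v then t * r y else 0)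
        = ∑ x, ∑ y, d v y * (t * c x * r y) := by
      rw [Finset.sum_comm, Finset.sum_comm (f := fun x y => d v y * (t * c x * r y))]
      refine Finset.sum_congr rfl fun y _ => ?_
      have : ∀ x, d v y * (t * c x * r y) = c x * (d v y * (t * r y)) := fun x => by ring
      simp [this, ← Finset.sum_mul, hc1]
    have hB : ∑ x, ∑ y, d x y * (if y = v then t * c x else 0)
        = ∑ x, ∑ y, d x v * (t * c x * r y) := by
      refine Finset.sum_congr rfl fun x _ => ?_
      have : ∀ y, d x v * (t * c x * r y) = r y * (d x v * (t * c x)) := fun y => by ring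
      simp [this, ← Finset.sum_mul, hr1]
    have hC : ∑ x, ∑ y, d x y * (t * c x * r y)
        ≤ ∑ x, ∑ y, d x v * (t * c x * r y) + ∑ x, ∑ y, d v y * (t * c x * r y) := by
      simp only [← Finset.sum_add_distrib, ← add_mul]
      exact Finset.sum_le_sum fun x _ => Finset.sum_le_sum fun y _ =>
        mul_le_mul_of_nonneg_right (htri x v y)
          (mul_nonneg (mul_nonneg ht.le (hc0 x)) (hr0 y))
    simp only [mul_add, mul_sub, Finset.sum_add_distrib, Finset.sum_sub_distrib] at hA hB hC ⊢
    linarith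

/-- The mass `t` can be removed from both marginals at `v` without increasing the cost. -/
lemma exists_reroute {d : V → V → ℝ} (hd : ∀ x, d x x = 0)
    (htri : ∀ x y z, d x z ≤ d x y + d y z)
    {f : V → V → ℝ} {p q : V → ℝ} (hf : ∀ x y, 0 ≤ f x y) (hp : ∀ x, ∑ y, f x y = p x)
    (hq : ∀ y, ∑ x, f x y = q y) (v : V) {t : ℝ}
    (htp : t ≤ p v) (htq : t ≤ q v) :
    ∃ g : V → V → ℝ, (∀ x y, 0 ≤ g x y) ∧
      (∀ x, ∑ y, g x y = p x - if x = v then t else 0) ∧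
      (∀ y, ∑ x, g x y = q y - if y = v then t else 0) ∧
      ∑ x, ∑ y, d x y * g x y ≤ ∑ x, ∑ y, d x y * f x y := by
  set a := min (f v v) t with ha
  set f' : V → V → ℝ := fun x y => f x y - if x = v then (if y = v then a else 0) else 0 with hf'
  have hf'0 : ∀ x y, 0 ≤ f' x y := by
    intro x y
    by_cases hx : x = v <;> by_cases hy : y = v
    · subst hx; subst hy; simp [hf', ha]
    all_goals simp [hf', hx, hy, hf]
  have hp' : ∀ x, ∑ y, f' x y = p x - if x = v then a else 0 := by
    intro x
    by_cases hx : x = v <;> simp [hf', hx, Finset.sum_sub_distrib, hp]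
  have hq' : ∀ y, ∑ x, f' x y = q y - if y = v then a else 0 := by
    intro y
    by_cases hy : y = v <;> simp [hf', hy, Finset.sum_sub_distrib, hq]
  have hcost : ∑ x, ∑ y, d x y * f' x y = ∑ x, ∑ y, d x y * f x y := by
    refine Finset.sum_congr rfl fun x _ => Finset.sum_congr rfl fun y _ => ?_
    by_cases hx : x = v <;> by_cases hy : y = v <;> simp [hf', hx, hy, hd]
  rcases le_or_gt t (f v v) with h | h
  · have hat : a = t := min_eq_right h
    rw [hat] at hp' hq'
    exact ⟨f', hf'0, hp', hq', hcost.le⟩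
  · have hav : a = f v v := min_eq_left h.le
    obtain ⟨g, hg, hgp, hgq, hgc⟩ := exists_reroute_of_loopless htri hf'0 hp' hq' (v := v)
      (by simp [hf', hav]) (t := t - a) (by linarith) (by simpa using htp) (by simpa using htq)
    refine ⟨g, hg, fun x => ?_, fun y => ?_, hgc.trans hcost.le⟩
    · rw [hgp]; split_ifs <;> ring
    · rw [hgq]; split_ifs <;> ring

/-- A transshipment plan can be turned into a coupling without increasing the cost. -/
lemma exists_coupling_of_transshipment {d : V → V → ℝ} (hd : ∀ x, d x x = 0)
    (htri : ∀ x y z, d x z ≤ d x y + d y z)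
    {f : V → V → ℝ} {μ ν s : V → ℝ} (hμ : ∀ x, 0 ≤ μ x) (hν : ∀ x, 0 ≤ ν x)
    (hf : ∀ x y, 0 ≤ f x y) (hp : ∀ x, ∑ y, f x y = μ x + s x)
    (hq : ∀ y, ∑ x, f x y = ν y + s y) :
    ∃ g : V → V → ℝ, (∀ x y, 0 ≤ g x y) ∧ (∀ x, ∑ y, g x y = μ x) ∧ (∀ y, ∑ x, g x y = ν y) ∧
      ∑ x, ∑ y, d x y * g x y ≤ ∑ x, ∑ y, d x y * f x y := by
  have key : ∀ S : Finset V, ∃ g : V → V → ℝ, (∀ x y, 0 ≤ g x y) ∧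
      (∀ x, ∑ y, g x y = μ x + if x ∈ S then 0 else s x) ∧
      (∀ y, ∑ x, g x y = ν y + if y ∈ S then 0 else s y) ∧
      ∑ x, ∑ y, d x y * g x y ≤ ∑ x, ∑ y, d x y * f x y := by
    intro S
    induction S using Finset.induction_on with
    | empty => exact ⟨f, hf, by simpa using hp, by simpa using hq, le_rfl⟩
    | insert v S hv ih =>
      obtain ⟨g, hg, hgp, hgq, hgc⟩ := ih
      obtain ⟨k, hk, hkp, hkq, hkc⟩ := exists_reroute hd htri hg hgp hgq v
        (t := s v) (by simp [hv, hμ]) (by simp [hv, hν])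
      refine ⟨k, hk, fun x => ?_, fun y => ?_, hkc.trans hgc⟩
      · rw [hkp]
        by_cases hx : x = v
        · subst hx; simp [hv]
        · simp [hx]
      · rw [hkq]
        by_cases hy : y = v
        · subst hy; simp [hv]
        · simp [hy]
  simpa using key Finset.univ

/-- A signed flow along the edges of a finite graph which transforms `μ` into `ν` yields a coupling
of cost at most the weighted `L¹`-norm of the flow. -/
lemma exists_coupling_of_edgeFlow {E : Type*} [Fintype E] {d : V → V → ℝ} (hd : ∀ x, d x x = 0)
    (hsymm : ∀ x y, d x y = d y x) (htri : ∀ x y z, d x z ≤ d x y + d y z)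
    (src tgt : E → V) (w : E → ℝ) {μ ν : V → ℝ} (hμ : ∀ x, 0 ≤ μ x) (hν : ∀ x, 0 ≤ ν x)
    (hw : ∀ x, ν x = μ x + ∑ e, (if tgt e = x then w e else 0)
      - ∑ e, (if src e = x then w e else 0)) :
    ∃ g : V → V → ℝ, (∀ x y, 0 ≤ g x y) ∧ (∀ x, ∑ y, g x y = μ x) ∧ (∀ y, ∑ x, g x y = ν y) ∧
      ∑ x, ∑ y, d x y * g x y ≤ ∑ e, d (src e) (tgt e) * |w e| := by
  set f : V → V → ℝ := fun x y => (if x = y then μ x else 0)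
    + ∑ e, ((if src e = x then (if tgt e = y then (w e)⁺ else 0) else 0)
      + (if tgt e = x then (if src e = y then (w e)⁻ else 0) else 0)) with hf
  set s : V → ℝ := fun x => ∑ e, ((if src e = x then (w e)⁺ else 0)
    + (if tgt e = x then (w e)⁻ else 0)) with hs
  have hf0 : ∀ x y, 0 ≤ f x y := fun x y => by
    refine add_nonneg (by split_ifs <;> simp [hμ]) (Finset.sum_nonneg fun e _ => ?_)
    have := posPart_nonneg (w e)
    have := negPart_nonneg (w e)
    split_ifs <;> positivity
  have hfp : ∀ x, ∑ y, f x y = μ x + s x := fun x => by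
    simp only [hf, hs, Finset.sum_add_distrib]
    rw [Finset.sum_comm, Finset.sum_comm
      (f := fun y e => if tgt e = x then (if src e = y then (w e)⁻ else 0) else 0)]
    congr 1
    · simp
    · congr 1 <;> refine Finset.sum_congr rfl fun e _ => ?_ <;> split_ifs <;> simp
  have hfq : ∀ y, ∑ x, f x y = ν y + s y := fun y => by
    have h1 : ∑ x, f x y = μ y + ∑ e, ((if tgt e = y then (w e)⁺ else 0)
        + (if src e = y then (w e)⁻ else 0)) := by
      simp only [hf, Finset.sum_add_distrib]
      rw [Finset.sum_comm, Finset.sum_comm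
        (f := fun x e => if tgt e = x then (if src e = y then (w e)⁻ else 0) else 0)]
      simp
    rw [h1, hw, add_sub_assoc, add_assoc, ← Finset.sum_sub_distrib, ← Finset.sum_add_distrib]
    congr 1
    refine Finset.sum_congr rfl fun e _ => ?_
    have := posPart_sub_negPart (w e)
    split_ifs <;> linarith
  have hcost : ∑ x, ∑ y, d x y * f x y = ∑ e, d (src e) (tgt e) * |w e| := by
    have h1 : ∀ x y, d x y * f x y =
        ∑ e, ((if src e = x then (if tgt e = y then d (src e) (tgt e) * (w e)⁺ else 0) else 0)
        + (if tgt e = x then (if src e = y then d (src e) (tgt e) * (w e)⁻ else 0) else 0)) := by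
      intro x y
      have h0 : d x y * (if x = y then μ x else 0) = 0 := by
        split_ifs with h
        · simp [h, hd]
        · simp
      simp only [hf]
      rw [mul_add, h0, zero_add, Finset.mul_sum]
      refine Finset.sum_congr rfl fun e _ => ?_
      rw [mul_add]
      congr 1
      · split_ifs with h h' <;> simp [*]
      · split_ifs with h h'
        · rw [hsymm, h, h']
        all_goals simp
    simp only [h1]
    have h2 : ∀ F : V → V → E → ℝ, ∑ x, ∑ y, ∑ e, F x y e = ∑ e, ∑ x, ∑ y, F x y e := by
      intro F
      rw [Finset.sum_comm]
      simp only [Finset.sum_comm (s := (Finset.univ : Finset V)) (t := (Finset.univ : Finset E))]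
      exact Finset.sum_congr rfl fun e _ => Finset.sum_comm
    rw [h2]
    refine Finset.sum_congr rfl fun e _ => ?_
    rw [← posPart_add_negPart (w e), mul_add]
    simp [Finset.sum_add_distrib]
  rw [← hcost]
  exact exists_coupling_of_transshipment hd htri hμ hν hf0 hfp hfq

end Transshipment

lemma entry_eq_sum {a b : ℕ} (δ : Fin a → Fin b → ℝ) (k l : ℤ) :
    entry δ k l = ∑ p : Fin a × Fin b, if (p.1 : ℤ) = k ∧ (p.2 : ℤ) = l then δ p.1 p.2 else 0 := by
  unfold entry
  split_ifs with h
  · rw [Finset.sum_eq_single (⟨k.toNat, by omega⟩, ⟨l.toNat, by omega⟩)]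
    · rw [if_pos]
      simp only [Int.ofNat_toNat]
      omega
    · rintro ⟨i, j⟩ - hne
      refine if_neg fun hij => hne ?_
      simp only [Prod.mk.injEq, Fin.ext_iff] at hij ⊢
      omega
    · simp
  · refine (Finset.sum_eq_zero fun p _ => if_neg fun hp => h ?_).symm
    omega

/-- The source of an edge of the grid. -/
def edgeSrc {n m : ℕ} : FlowIdx n m → Fin n × Fin m :=
  Sum.elim (fun p => (p.1, ⟨p.2, by omega⟩)) (fun p => (⟨p.1, by omega⟩, p.2))

/-- The target of an edge of the grid. -/
def edgeTgt {n m : ℕ} : FlowIdx n m → Fin n × Fin m :=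
  Sum.elim (fun p => (p.1, ⟨p.2 + 1, by omega⟩)) (fun p => (⟨p.1 + 1, by omega⟩, p.2))

lemma applyFlow_eq_sum {n m : ℕ} (μ : Fin n × Fin m → ℝ) (δ : Flow n m) (x : Fin n × Fin m) :
    applyFlow μ δ x = μ x + ∑ e, (if edgeTgt e = x then flat δ e else 0)
      - ∑ e, (if edgeSrc e = x then flat δ e else 0) := by
  have h1 : ∀ p : Fin n × Fin (m - 1), edgeTgt (Sum.inl p : FlowIdx n m) = x ↔
      (p.1 : ℤ) = x.1 ∧ (p.2 : ℤ) = (x.2 : ℤ) - 1 := fun p => by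
    simp only [edgeTgt, Sum.elim_inl, Prod.ext_iff, Fin.ext_iff]; omega
  have h2 : ∀ p : Fin (n - 1) × Fin m, edgeTgt (Sum.inr p : FlowIdx n m) = x ↔
      (p.1 : ℤ) = (x.1 : ℤ) - 1 ∧ (p.2 : ℤ) = x.2 := fun p => by
    simp only [edgeTgt, Sum.elim_inr, Prod.ext_iff, Fin.ext_iff]; omega
  have h3 : ∀ p : Fin n × Fin (m - 1), edgeSrc (Sum.inl p : FlowIdx n m) = x ↔
      (p.1 : ℤ) = x.1 ∧ (p.2 : ℤ) = x.2 := fun p => by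
    simp only [edgeSrc, Sum.elim_inl, Prod.ext_iff, Fin.ext_iff]; omega
  have h4 : ∀ p : Fin (n - 1) × Fin m, edgeSrc (Sum.inr p : FlowIdx n m) = x ↔
      (p.1 : ℤ) = x.1 ∧ (p.2 : ℤ) = x.2 := fun p => by
    simp only [edgeSrc, Sum.elim_inr, Prod.ext_iff, Fin.ext_iff]; omega
  simp only [applyFlow, entry_eq_sum, Fintype.sum_sum_type, h1, h2, h3, h4, flat, Sum.elim_inl,
    Sum.elim_inr]
  ring

lemma gd_nonneg {n m : ℕ} (x y : Fin n × Fin m) : 0 ≤ gd x y := by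
  unfold gd; positivity

lemma gd_self {n m : ℕ} (x : Fin n × Fin m) : gd x x = 0 := by
  simp [gd]

lemma gd_comm {n m : ℕ} (x y : Fin n × Fin m) : gd x y = gd y x := by
  simp only [gd, abs_sub_comm]

lemma gd_triangle {n m : ℕ} (x y z : Fin n × Fin m) : gd x z ≤ gd x y + gd y z := by
  unfold gd
  have h1 := abs_sub_le (x.1 : ℤ) y.1 z.1
  have h2 := abs_sub_le (x.2 : ℤ) y.2 z.2
  rw [← Int.cast_add, Int.cast_le]
  linarith

lemma gd_edge {n m : ℕ} (e : FlowIdx n m) : gd (edgeSrc e) (edgeTgt e) = 1 := by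
  rcases e with p | p <;> simp [gd, edgeSrc, edgeTgt]

/-- If `ν = Δ(μ, δ)` is a probability distribution, then `W₁(μ, ν) ≤ ‖δ‖₁`. -/
theorem W1_le_flowL1 (n m : ℕ) (μ : Fin n × Fin m → ℝ) (δ : Flow n m)
    (hμ : IsProbDist μ) (hν : IsProbDist (applyFlow μ δ)) :
    W1 μ (applyFlow μ δ) ≤ flowL1 δ := by
  obtain ⟨g, hg, hgp, hgq, hgc⟩ := exists_coupling_of_edgeFlow gd_self gd_comm gd_triangle
    edgeSrc edgeTgt (flat δ) hμ.1 hν.1 (applyFlow_eq_sum μ δ)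
  have hL : ∑ e, gd (edgeSrc e) (edgeTgt e) * |flat δ e| = flowL1 δ := by
    simp [gd_edge, flowL1, flat, Fintype.sum_prod_type]
  rw [hL] at hgc
  refine le_trans (csInf_le ⟨0, ?_⟩ ⟨fun p => g p.1 p.2, ⟨fun p => hg _ _, hgp, hgq⟩, rfl⟩) ?_
  · rintro c ⟨π, hπ, rfl⟩
    exact Finset.sum_nonneg fun p _ => mul_nonneg (gd_nonneg _ _) (hπ.1 p)
  · simpa [Fintype.sum_prod_type] using hgc

end WassersteinFlow
end

section
/- (Fine-tuned certification in the flow domain.) Let F be any function on ℝ^{nm}, R a probability distribution on the n×m pixel grid, A the matrix with Δ(R, δ) = R + Aδ, μ a probability distribution, δ^μ any flow with Δ(R, δ^μ) = μ, and ε > 0. Define F̃(δ) := F(Δ(R, δ)). If F̃(δ) = F̃(δ^μ) for every flow δ satisfying both ‖δ − δ^μ‖₁ < ε and Aδ + R ≥ 0 componentwise, then F(ν) = F(μ) for every probability distribution ν with W₁(μ, ν) < ε. -/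
namespace WassersteinFlow

/-- The value at `a` of the unit flow along a segment from coordinate `i` to coordinate `k`. -/
def segmentFlow (i k a : ℤ) : ℝ :=
  (if i ≤ a then 1 else 0) - (if k ≤ a then 1 else 0)

/-- The unit flow from `x` to `y` that first changes the row index, then the column index. -/
def pathFlow {n m : ℕ} (x y : Fin n × Fin m) : Flow n m :=
  (fun a b => if (a : ℤ) = y.1 then segmentFlow x.2 y.2 b else 0,
   fun a b => if (b : ℤ) = x.2 then segmentFlow x.1 y.1 a else 0)

/-- The linear combination of flows `D p` with coefficients `c p`. -/
def combineFlow {n m : ℕ} {ι : Type*} [Fintype ι] (c : ι → ℝ) (D : ι → Flow n m) : Flow n m :=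
  (fun a b => ∑ p, c p * (D p).1 a b, fun a b => ∑ p, c p * (D p).2 a b)

lemma entry_add {a b : ℕ} (δ η : Fin a → Fin b → ℝ) (i j : ℤ) :
    entry (δ + η) i j = entry δ i j + entry η i j := by
  unfold entry
  split_ifs <;> simp

lemma entry_sum_mul {a b : ℕ} {ι : Type*} [Fintype ι] (c : ι → ℝ)
    (D : ι → Fin a → Fin b → ℝ) (i j : ℤ) :
    entry (fun k l => ∑ p, c p * D p k l) i j = ∑ p, c p * entry (D p) i j := by
  unfold entry
  split_ifs <;> simp

lemma applyFlow_add {n m : ℕ} (μ : Fin n × Fin m → ℝ) (δ η : Flow n m) (x : Fin n × Fin m) :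
    applyFlow μ (δ + η) x = applyFlow μ δ x + applyFlow 0 η x := by
  simp only [applyFlow, Prod.fst_add, Prod.snd_add, entry_add, Pi.zero_apply]
  ring

lemma applyFlow_zero_combineFlow {n m : ℕ} {ι : Type*} [Fintype ι] (c : ι → ℝ)
    (D : ι → Flow n m) (x : Fin n × Fin m) :
    applyFlow 0 (combineFlow c D) x = ∑ p, c p * applyFlow 0 (D p) x := by
  simp only [applyFlow, combineFlow, entry_sum_mul, Pi.zero_apply, mul_add, mul_sub,
    Finset.sum_add_distrib, Finset.sum_sub_distrib, mul_zero, Finset.sum_const_zero]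

lemma entry_pathFlow_fst {n m : ℕ} (x y : Fin n × Fin m) (a b : ℤ) :
    entry (pathFlow x y).1 a b = if a = y.1 then segmentFlow x.2 y.2 b else 0 := by
  have h₁ := y.1.isLt
  have h₂ := y.2.isLt
  have h₃ := x.2.isLt
  unfold entry pathFlow segmentFlow
  grind

lemma entry_pathFlow_snd {n m : ℕ} (x y : Fin n × Fin m) (a b : ℤ) :
    entry (pathFlow x y).2 a b = if b = x.2 then segmentFlow x.1 y.1 a else 0 := by
  have h₁ := y.1.isLt
  have h₂ := x.1.isLt
  have h₃ := x.2.isLt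
  unfold entry pathFlow segmentFlow
  grind

lemma segmentFlow_pred_sub (i k a : ℤ) :
    segmentFlow i k (a - 1) - segmentFlow i k a =
      (if a = k then 1 else 0) - (if a = i then 1 else 0) := by
  unfold segmentFlow
  grind

lemma applyFlow_zero_pathFlow {n m : ℕ} (x y z : Fin n × Fin m) :
    applyFlow 0 (pathFlow x y) z = (if z = y then 1 else 0) - (if z = x then 1 else 0) := by
  have h₁ := segmentFlow_pred_sub x.1 y.1 z.1
  have h₂ := segmentFlow_pred_sub x.2 y.2 z.2
  simp only [applyFlow, entry_pathFlow_fst, entry_pathFlow_snd, Pi.zero_apply]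
  simp only [Nat.cast_inj, Fin.val_inj, Prod.ext_iff] at *
  grind

lemma sum_abs_segmentFlow_le (N i k : ℕ) :
    ∑ a : Fin N, |segmentFlow i k (a : ℕ)| ≤ |(i : ℝ) - k| := by
  rw [Fin.sum_univ_eq_sum_range (fun a => |segmentFlow i k (a : ℕ)|) N]
  have h (a : ℕ) : |segmentFlow i k a| = if a ∈ Finset.Ico (min i k) (max i k) then 1 else 0 := by
    simp only [segmentFlow, Finset.mem_Ico, Nat.cast_le]
    split_ifs <;> first | omega | simp
  simp only [h, Finset.sum_boole]
  have hc : (Finset.filter (· ∈ Finset.Ico (min i k) (max i k)) (Finset.range N)).card ≤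
      max i k - min i k := by
    rw [← Nat.card_Ico]
    exact Finset.card_le_card fun a ha => (Finset.mem_filter.mp ha).2
  rcases le_total i k with hik | hik
  · rw [abs_sub_comm]
    refine le_trans ?_ (le_abs_self _)
    rw [← Nat.cast_sub hik]
    simp only [max_eq_right hik, min_eq_left hik] at hc ⊢
    exact_mod_cast hc
  · refine le_trans ?_ (le_abs_self _)
    rw [← Nat.cast_sub hik]
    simp only [max_eq_left hik, min_eq_right hik] at hc ⊢
    exact_mod_cast hc

lemma flowL1_pathFlow_le {n m : ℕ} (x y : Fin n × Fin m) :
    flowL1 (pathFlow x y) ≤ gd x y := by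
  have h₁ := sum_abs_segmentFlow_le (n - 1) x.1 y.1
  have h₂ := sum_abs_segmentFlow_le (m - 1) x.2 y.2
  have e₁ : ∑ i, ∑ j, |(pathFlow x y).1 i j| =
      ∑ j : Fin (m - 1), |segmentFlow (x.2 : ℕ) (y.2 : ℕ) (j : ℕ)| := by
    rw [Finset.sum_comm]
    refine Finset.sum_congr rfl fun j _ => ?_
    simp [pathFlow, apply_ite, Fin.val_inj]
  have e₂ : ∑ i, ∑ j, |(pathFlow x y).2 i j| =
      ∑ i : Fin (n - 1), |segmentFlow (x.1 : ℕ) (y.1 : ℕ) (i : ℕ)| := by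
    refine Finset.sum_congr rfl fun i _ => ?_
    simp [pathFlow, apply_ite, Fin.val_inj]
  rw [flowL1, e₁, e₂, gd]
  push_cast
  linarith

lemma sum_abs_sum_mul_le {a b : ℕ} {ι : Type*} [Fintype ι] {c : ι → ℝ} (hc : ∀ p, 0 ≤ c p)
    (D : ι → Fin a → Fin b → ℝ) :
    ∑ i, ∑ j, |∑ p, c p * D p i j| ≤ ∑ p, c p * ∑ i, ∑ j, |D p i j| := by
  calc ∑ i, ∑ j, |∑ p, c p * D p i j|
      ≤ ∑ i, ∑ j, ∑ p, c p * |D p i j| := by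
        refine Finset.sum_le_sum fun i _ => Finset.sum_le_sum fun j _ => ?_
        refine (Finset.abs_sum_le_sum_abs _ _).trans_eq (Finset.sum_congr rfl fun p _ => ?_)
        rw [abs_mul, abs_of_nonneg (hc p)]
    _ = ∑ p, c p * ∑ i, ∑ j, |D p i j| := by
        simp only [Finset.mul_sum]
        rw [Finset.sum_comm (s := (Finset.univ : Finset ι))]
        exact Finset.sum_congr rfl fun i _ => Finset.sum_comm

lemma flowL1_combineFlow_le {n m : ℕ} {ι : Type*} [Fintype ι] {c : ι → ℝ} (hc : ∀ p, 0 ≤ c p)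
    (D : ι → Flow n m) :
    flowL1 (combineFlow c D) ≤ ∑ p, c p * flowL1 (D p) := by
  simp only [flowL1, mul_add, Finset.sum_add_distrib]
  exact add_le_add (sum_abs_sum_mul_le hc _) (sum_abs_sum_mul_le hc _)

lemma isCoupling_mul {n m : ℕ} {μ ν : Fin n × Fin m → ℝ} (hμ : IsProbDist μ)
    (hν : IsProbDist ν) : IsCoupling μ ν fun p => μ p.1 * ν p.2 :=
  ⟨fun p => mul_nonneg (hμ.1 _) (hν.1 _),
    fun x => by simp only [← Finset.mul_sum, hν.2, mul_one],
    fun y => by simp only [← Finset.sum_mul, hμ.2, one_mul]⟩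

/-- A coupling induces a flow that transports `μ` to `ν` at no larger cost. -/
lemma exists_flow_of_isCoupling {n m : ℕ} {μ ν : Fin n × Fin m → ℝ}
    {π : (Fin n × Fin m) × (Fin n × Fin m) → ℝ} (hπ : IsCoupling μ ν π) :
    ∃ η : Flow n m, (∀ z, applyFlow 0 η z = ν z - μ z) ∧ flowL1 η ≤ ∑ p, gd p.1 p.2 * π p := by
  refine ⟨combineFlow π fun p => pathFlow p.1 p.2, fun z => ?_, ?_⟩
  · rw [applyFlow_zero_combineFlow]
    simp only [applyFlow_zero_pathFlow, mul_sub, Finset.sum_sub_distrib, mul_ite, mul_one, mul_zero]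
    congr 1
    · rw [Fintype.sum_prod_type, ← hπ.2.2 z]
      simp
    · rw [Fintype.sum_prod_type_right, ← hπ.2.1 z]
      simp
  · refine (flowL1_combineFlow_le hπ.1 _).trans (Finset.sum_le_sum fun p _ => ?_)
    rw [mul_comm]
    exact mul_le_mul_of_nonneg_right (flowL1_pathFlow_le _ _) (hπ.1 p)

/-- Fine-tuned certification in the flow domain: if `F̃(δ) = F̃(δ^μ)` for every flow
`δ` with `‖δ − δ^μ‖₁ < ε` and `Aδ + R ≥ 0` componentwise, then `F(ν) = F(μ)` for
every probability distribution `ν` with `W₁(μ, ν) < ε`. -/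
theorem fine_tuned_certification_in_flow_domain {α : Type*} (n m : ℕ)
    (F : (Fin n × Fin m → ℝ) → α)
    (R μ : Fin n × Fin m → ℝ) (hR : IsProbDist R) (hμ : IsProbDist μ)
    (A : Matrix (Fin n × Fin m) (FlowIdx n m) ℝ)
    (hA : ∀ δ : Flow n m, applyFlow R δ = R + A.mulVec (flat δ))
    (δμ : Flow n m) (hδμ : applyFlow R δμ = μ)
    (ε : ℝ) (hε : 0 < ε)
    (hcert : ∀ δ : Flow n m, flowL1 (δ - δμ) < ε →
      (∀ x, 0 ≤ A.mulVec (flat δ) x + R x) →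
      F (applyFlow R δ) = F (applyFlow R δμ)) :
    ∀ ν : Fin n × Fin m → ℝ, IsProbDist ν → W1 μ ν < ε → F ν = F μ := by
  intro ν hν hW
  obtain ⟨_, ⟨π, hπ, rfl⟩, hcost⟩ := exists_lt_of_csInf_lt (by
    exact ⟨_, _, isCoupling_mul hμ hν, rfl⟩) hW
  obtain ⟨η, hη, hηL⟩ := exists_flow_of_isCoupling hπ
  have happ : applyFlow R (δμ + η) = ν := by
    ext z
    rw [applyFlow_add, hδμ, hη]
    ring
  have h := hcert (δμ + η) (by rw [add_sub_cancel_left]; exact hηL.trans_lt hcost) fun x => by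
    rw [add_comm, ← Pi.add_apply, ← hA, happ]
    exact hν.1 x
  rwa [happ, hδμ] at h

end WassersteinFlow
end

section
/- (Fine-tuned perturbation solution for linear classifiers, part 1.) In the setting of linear classifiers with w_t := (WA)_y − (WA)_t and d_t := (WR + b)_y − (WR + b)_t for each class t ≠ y, define for each t: α̃_t := min { ‖δ − δ^μ‖₁ : Aδ + R ≥ 0 and w_tᵀδ + d_t ≤ 0 } (taking +∞ if no such δ exists), and ε̃ := min_{t≠y} α̃_t. Also let ε := min_{t≠y} |w_tᵀδ^μ + d_t| / ‖w_t‖_∞ be the unrestricted L1 distance to the decision boundaries. Then ε̃ ≥ ε. -/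
namespace WassersteinFlow

theorem flowL1_eq_sum_flat {n m : ℕ} (δ : Flow n m) : flowL1 δ = ∑ k, |flat δ k| := by
  simp [flowL1, flat, Fintype.sum_sum_type, Fintype.sum_prod_type]

theorem flat_sub {n m : ℕ} (δ δ' : Flow n m) : flat (δ - δ') = flat δ - flat δ' := by
  ext (k | k) <;> rfl

/-- Hölder's inequality between the `ℓ^∞` and `ℓ¹` norms on a finite index type. -/
theorem abs_sum_mul_le_iSup_mul_sum {ι : Type*} [Fintype ι] (w v : ι → ℝ) :
    |∑ k, w k * v k| ≤ (⨆ k, |w k|) * ∑ k, |v k| := by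
  rw [Finset.mul_sum]
  refine (Finset.abs_sum_le_sum_abs _ _).trans (Finset.sum_le_sum fun k _ => ?_)
  rw [abs_mul]
  gcongr
  exact le_ciSup (Set.finite_range fun k => |w k|).bddAbove k

theorem iSup_abs_pos {ι : Type*} [Finite ι] {w : ι → ℝ} (hw : w ≠ 0) : 0 < ⨆ k, |w k| := by
  obtain ⟨k, hk⟩ := Function.ne_iff.mp hw
  exact (abs_pos.mpr hk).trans_le (le_ciSup (Set.finite_range fun k => |w k|).bddAbove k)

/-- The score margin of `R + A v` is the affine function of `v` with slope `(WA)_y - (WA)_t`. -/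
theorem margin_add_mulVec {ι κ τ : Type*} [Fintype ι] [Fintype κ] (W : Matrix τ ι ℝ) (b : τ → ℝ)
    (R : ι → ℝ) (A : Matrix ι κ ℝ) (v : κ → ℝ) (y t : τ) :
    (∑ k, ((W * A) y k - (W * A) t k) * v k) + ((W.mulVec R + b) y - (W.mulVec R + b) t) =
      (W.mulVec (R + A.mulVec v) + b) y - (W.mulVec (R + A.mulVec v) + b) t := by
  have h : ∀ s, ∑ k, (W * A) s k * v k = (W.mulVec (A.mulVec v)) s := fun s => by
    rw [Matrix.mulVec_mulVec]; rfl
  simp only [sub_mul, Finset.sum_sub_distrib, h, Matrix.mulVec_add, Pi.add_apply]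
  ring

/-- Fine-tuned perturbation solution for linear classifiers, part 1: `ε̃ ≥ ε`,
i.e. every flow `δ` with `Aδ + R ≥ 0` and `w_tᵀδ + d_t ≤ 0` (for some class
`t ≠ y`) satisfies `‖δ − δ^μ‖₁ ≥ ε`, where
`ε = min_{t≠y} |w_tᵀδ^μ + d_t| / ‖w_t‖_∞`. -/
theorem fine_tuned_perturbation_linear_ge (n m C : ℕ)
    (W : Matrix (Fin C) (Fin n × Fin m) ℝ) (b : Fin C → ℝ)
    (μ : Fin n × Fin m → ℝ) (hμ : IsProbDist μ)
    (y : Fin C) (hy : ∀ t, (W.mulVec μ + b) t ≤ (W.mulVec μ + b) y)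
    (R : Fin n × Fin m → ℝ) (hR : IsProbDist R)
    (A : Matrix (Fin n × Fin m) (FlowIdx n m) ℝ)
    (hA : ∀ δ : Flow n m, applyFlow R δ = R + A.mulVec (flat δ))
    (δμ : Flow n m) (hδμ : applyFlow R δμ = μ)
    (hw : ∀ t, t ≠ y → (fun k => (W * A) y k - (W * A) t k) ≠ 0)
    (ε : ℝ)
    (hε : ε = sInf {r | ∃ t, t ≠ y ∧
      r = |(∑ k, ((W * A) y k - (W * A) t k) * flat δμ k) +
            ((W.mulVec R + b) y - (W.mulVec R + b) t)| /
          (⨆ k, |(W * A) y k - (W * A) t k|)}) :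
    ∀ t, t ≠ y → ∀ δ : Flow n m,
      (∀ x, 0 ≤ A.mulVec (flat δ) x + R x) →
      (∑ k, ((W * A) y k - (W * A) t k) * flat δ k) +
        ((W.mulVec R + b) y - (W.mulVec R + b) t) ≤ 0 →
      ε ≤ flowL1 (δ - δμ) := by
  intro t ht δ _ hδ
  have hmargin : 0 ≤ (∑ k, ((W * A) y k - (W * A) t k) * flat δμ k) +
      ((W.mulVec R + b) y - (W.mulVec R + b) t) := by
    rw [margin_add_mulVec, ← hA, hδμ]
    exact sub_nonneg.mpr (hy t)
  have hpos := iSup_abs_pos (hw t ht)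
  have hle : ε ≤ _ := hε.trans_le (csInf_le ⟨0, by
    rintro _ ⟨s, -, rfl⟩
    exact div_nonneg (abs_nonneg _) (Real.iSup_nonneg fun _ => abs_nonneg _)⟩ ⟨t, ht, rfl⟩)
  refine hle.trans ((div_le_iff₀ hpos).mpr ?_)
  have hholder := (neg_le_abs _).trans (abs_sum_mul_le_iSup_mul_sum
    (fun k => (W * A) y k - (W * A) t k) (flat (δ - δμ)))
  rw [← flowL1_eq_sum_flat, flat_sub] at hholder
  simp only [Pi.sub_apply, mul_sub _ (flat δ _), Finset.sum_sub_distrib] at hholder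
  rw [abs_of_nonneg hmargin, mul_comm]
  linarith

end WassersteinFlow
end
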